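/- Let Γ be a superstable graph such that 3 ∉ B_Γ but some m ∈ B_Γ satisfies m > 3. Then b₁(Γ) = 4 and Γ is the 'fat triangle': three vertices pairwise joined by double edges. -/

import Mathlib

/-!
A finite multigraph on vertex type `V` with edge type `E`: each edge has a
(possibly diagonal, i.e. loop) unordered pair of endpoints in `Sym2 V`.
-/
structure Multigraph (V E : Type) where
  ends : E → Sym2 V

namespace Multigraph

variable {V E : Type} [Fintype V] [Fintype E] [DecidableEq V] [DecidableEq E]
variable (G : Multigraph V E)

/-- Valency of the vertex `v` in the subgraph with edge set `Δ`; a loop counts twice. -/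
def deg (Δ : Finset E) (v : V) : ℕ :=
  ∑ e ∈ Δ, (if G.ends e = Sym2.diag v then 2 else if v ∈ G.ends e then 1 else 0)

/-- `Δ` is a cyclic subgraph (even subset of edges): all valencies are even. -/
def IsCyclic (Δ : Finset E) : Prop := ∀ v, Even (G.deg Δ v)

instance (Δ : Finset E) : Decidable (G.IsCyclic Δ) :=
  decidable_of_iff (∀ v, Even (G.deg Δ v)) Iff.rfl

/-- Vertices of the subgraph generated by the edge set `Δ`. -/
def verts (Δ : Finset E) : Finset V :=
  Finset.univ.filter (fun v => ∃ e ∈ Δ, v ∈ G.ends e)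

/-- Adjacency through an edge of `Δ`. -/
def Adj (Δ : Finset E) (v w : V) : Prop := ∃ e ∈ Δ, G.ends e = s(v, w)

/-- Connectedness relation of the subgraph with edge set `Δ`. -/
def Reach (Δ : Finset E) : V → V → Prop := Relation.ReflTransGen (G.Adj Δ)

/-- Number of connected components of the subgraph generated by `Δ`
(only vertices incident to an edge of `Δ` are taken into account). -/
noncomputable def ncomp (Δ : Finset E) : ℕ :=
  Set.ncard { S : Set V | ∃ v ∈ G.verts Δ, S = {w | G.Reach Δ v w} }

/-- Number of connected components of the spanning subgraph `(V, Δ)`. -/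
noncomputable def ncompSpanning (Δ : Finset E) : ℕ :=
  Set.ncard { S : Set V | ∃ v : V, S = {w | G.Reach Δ v w} }

/-- First Betti number `|E(Δ)| - |V(Δ)| + c(Δ)` of the subgraph generated by `Δ`. -/
noncomputable def b1 (Δ : Finset E) : ℤ :=
  (Δ.card : ℤ) - (G.verts Δ).card + G.ncomp Δ

/-- The set of cyclic Betti numbers `B_Γ = {b₁(Δ) | Δ cyclic}`. -/
noncomputable def B : Set ℤ := { n | ∃ Δ : Finset E, G.IsCyclic Δ ∧ G.b1 Δ = n }

/-- The boundary of an `𝔽₂` 1-chain: an edge is sent to the sum of its endpoints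
(so a loop is sent to `0`). -/
def bndFun (x : E → ZMod 2) (v : V) : ZMod 2 :=
  ∑ e : E, x e * (if (G.ends e).IsDiag then 0 else if v ∈ G.ends e then 1 else 0)

/-- The boundary operator as an `𝔽₂`-linear map. -/
def bnd : (E → ZMod 2) →ₗ[ZMod 2] (V → ZMod 2) where
  toFun := G.bndFun
  map_add' x y := by
    funext v
    simp only [bndFun, Pi.add_apply, ← Finset.sum_add_distrib]
    exact Finset.sum_congr rfl fun e _ => by ring
  map_smul' c x := by
    funext v
    simp only [bndFun, Pi.smul_apply, smul_eq_mul, Finset.mul_sum, RingHom.id_apply]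
    exact Finset.sum_congr rfl fun e _ => by ring

/-- The cycle space `𝒞_Γ = ker ∂`. -/
def cycleSpace : Submodule (ZMod 2) (E → ZMod 2) := LinearMap.ker G.bnd

/-- The `𝔽₂` 1-chain associated to a set of edges. -/
def chainOf (Δ : Finset E) : E → ZMod 2 := fun e => if e ∈ Δ then 1 else 0

/-- Chains supported on a subset `E'` of the edges. -/
def supportedOn (E' : Finset E) : Submodule (ZMod 2) (E → ZMod 2) where
  carrier := {x | ∀ e, e ∉ E' → x e = 0}
  add_mem' := by intro x y hx hy e he; simp [hx e he, hy e he]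
  zero_mem' := by intro e he; rfl
  smul_mem' := by intro c x hx e he; simp [hx e he]

/-- The cycle space of the subgraph of `G` with edge set `E'`. -/
def cycleSpaceOn (E' : Finset E) : Submodule (ZMod 2) (E → ZMod 2) :=
  G.cycleSpace ⊓ supportedOn E'

/-- The set of cyclic Betti numbers of the subgraph with edge set `E'`. -/
noncomputable def BOn (E' : Finset E) : Set ℤ :=
  { n | ∃ Δ ⊆ E', G.IsCyclic Δ ∧ G.b1 Δ = n }

/-- `N` is a separating edge: deleting it increases the number of connected components. -/
def Separating (N : E) : Prop :=
  G.ncompSpanning Finset.univ < G.ncompSpanning (Finset.univ \ {N})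

/-- `G` is eulerian: every valency is even. -/
def Eulerian : Prop := ∀ v, Even (G.deg Finset.univ v)

/-- `G` is superstable: every vertex has valency at least `3`, except possibly
a vertex carrying a loop. -/
def Superstable : Prop :=
  ∀ v ∈ G.verts Finset.univ, 3 ≤ G.deg Finset.univ v ∨ ∃ e : E, G.ends e = Sym2.diag v

/-- A circuit: a nonempty connected subgraph all of whose valencies equal `2`. -/
def IsCircuit (Δ : Finset E) : Prop :=
  Δ.Nonempty ∧ (∀ v ∈ G.verts Δ, G.deg Δ v = 2) ∧
    ∀ v ∈ G.verts Δ, ∀ w ∈ G.verts Δ, G.Reach Δ v w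

/-- `G` is connected. -/
def Conn : Prop :=
  ∀ v ∈ G.verts Finset.univ, ∀ w ∈ G.verts Finset.univ, G.Reach Finset.univ v w

/-- The edges of `G` that are not separating. -/
noncomputable def nonSepEdges : Finset E :=
  @Finset.filter _ (fun N => ¬ G.Separating N) (Classical.decPred _) Finset.univ

end Multigraph
/-- `Γ` is the fat triangle: three vertices pairwise joined by exactly two
edges, and no other edges or vertices. -/
def Multigraph.IsFatTriangle {V E : Type} [Fintype V] [Fintype E]
    [DecidableEq V] [DecidableEq E] (G : Multigraph V E) : Prop :=
  ∃ a b c : V, a ≠ b ∧ a ≠ c ∧ b ≠ c ∧ G.verts Finset.univ = {a, b, c} ∧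
    (∀ e : E, ¬ (G.ends e).IsDiag) ∧
    (Finset.univ.filter fun e : E => G.ends e = s(a, b)).card = 2 ∧
    (Finset.univ.filter fun e : E => G.ends e = s(a, c)).card = 2 ∧
    (Finset.univ.filter fun e : E => G.ends e = s(b, c)).card = 2

set_option linter.unusedSectionVars false

namespace Multigraph

variable {V E : Type} [Fintype V] [Fintype E] [DecidableEq V] [DecidableEq E]
variable (G : Multigraph V E)

/-! ### Degrees -/

/-- The contribution of the edge `e` to the valency of `v`. -/
def inc (e : E) (v : V) : ℕ :=
  if G.ends e = Sym2.diag v then 2 else if v ∈ G.ends e then 1 else 0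

lemma deg_eq_sum_inc (S : Finset E) (v : V) : G.deg S v = ∑ e ∈ S, G.inc e v := rfl

lemma mem_verts {S : Finset E} {v : V} : v ∈ G.verts S ↔ ∃ e ∈ S, v ∈ G.ends e := by
  simp [verts]

lemma inc_eq {e : E} {a b : V} (h : G.ends e = s(a, b)) (v : V) :
    G.inc e v = (if a = v then 1 else 0) + (if b = v then 1 else 0) := by
  unfold inc
  simp only [h, Sym2.diag, Sym2.mem_iff, Sym2.eq_iff]
  grind

lemma sum_inc {e : E} {a b : V} (h : G.ends e = s(a, b)) (T : Finset V) :
    ∑ v ∈ T, G.inc e v = (if a ∈ T then 1 else 0) + (if b ∈ T then 1 else 0) := by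
  simp only [G.inc_eq h, Finset.sum_add_distrib, Finset.sum_ite_eq]

lemma inc_pos_iff {e : E} {v : V} : 0 < G.inc e v ↔ v ∈ G.ends e := by
  induction h : G.ends e with
  | _ a b =>
    rw [G.inc_eq h, Sym2.mem_iff]
    grind

lemma deg_pos_iff {S : Finset E} {v : V} : 0 < G.deg S v ↔ v ∈ G.verts S := by
  simp [deg_eq_sum_inc, Nat.pos_iff_ne_zero, mem_verts, ← inc_pos_iff]

lemma deg_eq_zero {S : Finset E} {v : V} (h : v ∉ G.verts S) : G.deg S v = 0 := by
  rw [← deg_pos_iff] at h; omega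

lemma deg_union {S T : Finset E} (h : Disjoint S T) (v : V) :
    G.deg (S ∪ T) v = G.deg S v + G.deg T v := Finset.sum_union h

lemma deg_sdiff {S T : Finset E} (h : S ⊆ T) (v : V) :
    G.deg (T \ S) v + G.deg S v = G.deg T v := Finset.sum_sdiff h

lemma deg_symmDiff (S T : Finset E) (v : V) :
    G.deg (symmDiff S T) v + 2 * G.deg (S ∩ T) v = G.deg S v + G.deg T v := by
  have h1 := G.deg_sdiff (Finset.inter_subset_left : S ∩ T ⊆ S) v
  have h2 := G.deg_sdiff (Finset.inter_subset_right : S ∩ T ⊆ T) v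
  have h3 : symmDiff S T = (S \ (S ∩ T)) ∪ (T \ (S ∩ T)) := by
    ext e; grind [Finset.mem_symmDiff]
  rw [h3, deg_union]
  · omega
  · exact Finset.disjoint_left.2 fun e h h' => by grind

lemma even_sum_deg {S : Finset E} {U : Finset V}
    (h : ∀ e ∈ S, ∀ a b, G.ends e = s(a, b) → (a ∈ U ↔ b ∈ U)) :
    Even (∑ v ∈ U, G.deg S v) := by
  simp only [deg_eq_sum_inc]
  rw [Finset.sum_comm]
  refine Finset.even_sum _ fun e he => ?_
  induction h' : G.ends e with
  | _ a b =>
    rw [G.sum_inc h']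
    simp only [h e he a b h']
    exact ⟨_, rfl⟩

lemma sum_deg {S : Finset E} {U : Finset V} (h : G.verts S ⊆ U) :
    ∑ v ∈ U, G.deg S v = 2 * S.card := by
  simp only [deg_eq_sum_inc]
  rw [Finset.sum_comm, Finset.sum_congr rfl (g := fun _ => 2), Finset.sum_const, smul_eq_mul,
    mul_comm]
  intro e he
  induction h' : G.ends e with
  | _ a b =>
    rw [G.sum_inc h', if_pos (h (G.mem_verts.2 ⟨e, he, by simp [h']⟩)),
      if_pos (h (G.mem_verts.2 ⟨e, he, by simp [h']⟩))]

/-- If at most one vertex of a vertex set closed under adjacency has odd valency,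
then none has. -/
lemma even_deg_of_forall_ne {S : Finset E} {U : Finset V} {r : V} (hr : r ∈ U)
    (h : ∀ e ∈ S, ∀ a b, G.ends e = s(a, b) → (a ∈ U ↔ b ∈ U))
    (hev : ∀ v ∈ U, v ≠ r → Even (G.deg S v)) : Even (G.deg S r) := by
  have h1 := G.even_sum_deg h
  rw [← Finset.add_sum_erase _ _ hr, Nat.even_add] at h1
  refine h1.2 (Finset.even_sum _ fun v hv => ?_)
  rw [Finset.mem_erase] at hv
  exact hev v hv.2 hv.1

lemma isCyclic_of_forall_ne {S : Finset E} (r : V)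
    (hev : ∀ v, v ≠ r → Even (G.deg S v)) : G.IsCyclic S := by
  intro v
  by_cases hv : v = r
  · subst hv
    exact G.even_deg_of_forall_ne (Finset.mem_univ _) (by simp) fun w _ => hev w
  · exact hev v hv

lemma isCyclic_empty : G.IsCyclic ∅ := fun v => by simp [deg]

variable {G}

lemma IsCyclic.symmDiff {S T : Finset E} (hS : G.IsCyclic S) (hT : G.IsCyclic T) :
    G.IsCyclic (symmDiff S T) := fun v => by
  have := G.deg_symmDiff S T v
  have := hS v
  have := hT v
  rw [Nat.even_iff] at *
  omega

lemma IsCyclic.union {S T : Finset E} (hS : G.IsCyclic S) (hT : G.IsCyclic T)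
    (h : Disjoint S T) : G.IsCyclic (S ∪ T) := fun v => by
  rw [G.deg_union h]; exact (hS v).add (hT v)

lemma IsCyclic.sdiff {S T : Finset E} (hS : G.IsCyclic S) (hT : G.IsCyclic T)
    (h : S ⊆ T) : G.IsCyclic (T \ S) := fun v => by
  have := G.deg_sdiff h v
  have := hS v
  have := hT v
  rw [Nat.even_iff] at *
  omega

variable (G)

lemma verts_union (S T : Finset E) : G.verts (S ∪ T) = G.verts S ∪ G.verts T := by
  ext v; simp only [mem_verts, Finset.mem_union, or_and_right, exists_or]

variable {G} in
lemma verts_mono {S T : Finset E} (h : S ⊆ T) : G.verts S ⊆ G.verts T := fun v hv => by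
  obtain ⟨e, he, h'⟩ := G.mem_verts.1 hv
  exact G.mem_verts.2 ⟨e, h he, h'⟩

/-! ### Connected components -/

variable {G} in
lemma Reach.mono {S T : Finset E} (h : S ⊆ T) {v w : V} (hr : G.Reach S v w) :
    G.Reach T v w :=
  Relation.ReflTransGen.mono (r := G.Adj S) (p := G.Adj T)
    (fun _ _ ⟨e, he, h'⟩ => ⟨e, h he, h'⟩) v w hr

variable {G} in
lemma Reach.symm {S : Finset E} {v w : V} (hr : G.Reach S v w) : G.Reach S w v :=
  haveI : Std.Symm (G.Adj S) := ⟨fun _ _ ⟨e, he, h'⟩ => ⟨e, he, by rw [h', Sym2.eq_swap]⟩⟩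
  Relation.ReflTransGen.stdSymm.symm v w hr

lemma exists_roots (S : Finset E) : ∃ R ⊆ G.verts S, R.card = G.ncomp S ∧
    (∀ v ∈ G.verts S, ∃ r ∈ R, G.Reach S r v) ∧
    ∀ r ∈ R, ∀ r' ∈ R, G.Reach S r r' → r = r' := by
  classical
  obtain ⟨R, hR, hbij⟩ := Set.exists_subset_bijOn (↑(G.verts S) : Set V)
    (fun v => {w | G.Reach S v w})
  have hfin : R.Finite := Set.toFinite R
  refine ⟨hfin.toFinset, ?_, ?_, ?_, ?_⟩
  · intro v hv; exact hR (hfin.mem_toFinset.1 hv)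
  · rw [← Set.ncard_eq_toFinset_card, ncomp, ← hbij.injOn.ncard_image, hbij.image_eq]
    congr 1
    ext T; simp [eq_comm]
  · intro v hv
    obtain ⟨r, hr, h⟩ := hbij.surjOn ⟨v, hv, rfl⟩
    refine ⟨r, hfin.mem_toFinset.2 hr, ?_⟩
    exact (Set.ext_iff.1 h v).2 Relation.ReflTransGen.refl
  · intro r hr r' hr' h
    refine hbij.injOn (hfin.mem_toFinset.1 hr) (hfin.mem_toFinset.1 hr') ?_
    ext w
    exact ⟨fun hw => h.symm.trans hw, fun hw => h.trans hw⟩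

lemma ncomp_le_card {S : Finset E} (R : Finset V)
    (h : ∀ v ∈ G.verts S, ∃ r ∈ R, G.Reach S r v) : G.ncomp S ≤ R.card := by
  have h1 : {T : Set V | ∃ v ∈ G.verts S, T = {w | G.Reach S v w}} ⊆
      (fun r => {w | G.Reach S r w}) '' (↑R : Set V) := by
    rintro T ⟨v, hv, rfl⟩
    obtain ⟨r, hr, hrv⟩ := h v hv
    refine ⟨r, hr, ?_⟩
    ext w
    exact ⟨fun hw => hrv.symm.trans hw, fun hw => hrv.trans hw⟩
  calc G.ncomp S ≤ _ := Set.ncard_le_ncard h1 (Set.toFinite _)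
    _ ≤ (↑R : Set V).ncard := Set.ncard_image_le (Set.toFinite _)
    _ = R.card := Set.ncard_coe_finset R

lemma verts_nonempty {S : Finset E} (h : S.Nonempty) : (G.verts S).Nonempty := by
  obtain ⟨e, he⟩ := h
  induction h' : G.ends e with
  | _ a b => exact ⟨a, G.mem_verts.2 ⟨e, he, by simp [h']⟩⟩

lemma ncomp_pos {S : Finset E} (h : S.Nonempty) : 1 ≤ G.ncomp S := by
  obtain ⟨R, -, hc, hR, -⟩ := G.exists_roots S
  obtain ⟨v, hv⟩ := G.verts_nonempty h
  obtain ⟨r, hr, -⟩ := hR v hv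
  rw [← hc]
  exact Finset.card_pos.2 ⟨r, hr⟩

lemma ncomp_union_le (S T : Finset E) : G.ncomp (S ∪ T) ≤ G.ncomp S + G.ncomp T := by
  obtain ⟨R, -, hc, hR, -⟩ := G.exists_roots S
  obtain ⟨R', -, hc', hR', -⟩ := G.exists_roots T
  rw [← hc, ← hc']
  refine (G.ncomp_le_card (R ∪ R') fun v hv => ?_).trans (Finset.card_union_le _ _)
  rw [verts_union, Finset.mem_union] at hv
  rcases hv with hv | hv
  · obtain ⟨r, hr, h⟩ := hR v hv
    exact ⟨r, Finset.mem_union_left _ hr, h.mono Finset.subset_union_left⟩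
  · obtain ⟨r, hr, h⟩ := hR' v hv
    exact ⟨r, Finset.mem_union_right _ hr, h.mono Finset.subset_union_right⟩

lemma reach_of_ncomp_eq_one {S : Finset E} (h : G.ncomp S = 1) {v w : V}
    (hv : v ∈ G.verts S) (hw : w ∈ G.verts S) : G.Reach S v w := by
  obtain ⟨R, -, hc, hR, -⟩ := G.exists_roots S
  obtain ⟨r, hr, hrv⟩ := hR v hv
  obtain ⟨r', hr', hrw⟩ := hR w hw
  have := Finset.card_le_one.1 (hc.trans h).le r hr r' hr'
  subst this
  exact hrv.symm.trans hrw

lemma ncomp_union_le_of_inter {S T : Finset E} (hT : G.ncomp T = 1)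
    (h : (G.verts S ∩ G.verts T).Nonempty) : G.ncomp (S ∪ T) ≤ G.ncomp S := by
  obtain ⟨R, -, hc, hR, -⟩ := G.exists_roots S
  obtain ⟨u, hu⟩ := h
  rw [Finset.mem_inter] at hu
  rw [← hc]
  refine G.ncomp_le_card R fun v hv => ?_
  rw [verts_union, Finset.mem_union] at hv
  rcases hv with hv | hv
  · obtain ⟨r, hr, h⟩ := hR v hv
    exact ⟨r, hr, h.mono Finset.subset_union_left⟩
  · obtain ⟨r, hr, h⟩ := hR u hu.1
    exact ⟨r, hr, (h.mono Finset.subset_union_left).trans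
      ((G.reach_of_ncomp_eq_one hT hu.2 hv).mono Finset.subset_union_right)⟩

/-! ### The number of cyclic subgraphs -/

variable {G} in
/-- Two connected vertices are the only odd vertices of some subgraph. -/
lemma Reach.exists_odd {S : Finset E} {v w : V} (h : G.Reach S v w) (hvw : v ≠ w) :
    ∃ P ⊆ S, ∀ u, Odd (G.deg P u) ↔ u = v ∨ u = w := by
  suffices H : ∃ P ⊆ S, ∀ u, G.deg P u % 2 =
      ((if v = u then 1 else 0) + (if w = u then 1 else 0)) % 2 by
    obtain ⟨P, hP, hd⟩ := H
    refine ⟨P, hP, fun u => ?_⟩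
    rw [Nat.odd_iff, hd]
    grind
  clear hvw
  induction h with
  | refl => exact ⟨∅, by simp, fun u => by simp [deg]; split_ifs <;> rfl⟩
  | @tail b c _ hbc ih =>
    obtain ⟨P, hP, hd⟩ := ih
    obtain ⟨e, he, hends⟩ := hbc
    refine ⟨symmDiff P {e}, fun f hf => ?_, fun u => ?_⟩
    · rw [Finset.mem_symmDiff, Finset.mem_singleton] at hf
      rcases hf with hf | hf
      · exact hP hf.1
      · exact hf.1 ▸ he
    · have h1 := G.deg_symmDiff P {e} u
      have h2 : G.deg {e} u = (if b = u then 1 else 0) + (if c = u then 1 else 0) := by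
        rw [deg_eq_sum_inc, Finset.sum_singleton, G.inc_eq hends u]
      have h3 := hd u
      omega

/-- The cyclic subgraphs contained in `S`. -/
def cyclics (S : Finset E) : Finset (Finset E) := S.powerset.filter G.IsCyclic

variable {G} in
lemma mem_cyclics {S T : Finset E} : T ∈ G.cyclics S ↔ T ⊆ S ∧ G.IsCyclic T := by
  simp [cyclics]

lemma exists_subset_odd (S : Finset E) (R : Finset V)
    (hR : ∀ v ∈ G.verts S, ∃ r ∈ R, G.Reach S r v) (T : Finset V)
    (hT : T ⊆ G.verts S \ R) :
    ∃ P ⊆ S, (G.verts S \ R).filter (fun v => Odd (G.deg P v)) = T := by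
  induction T using Finset.induction_on with
  | empty => exact ⟨∅, by simp, by simp [deg]⟩
  | @insert v T hv ih =>
    obtain ⟨P, hP, hPT⟩ := ih ((Finset.subset_insert _ _).trans hT)
    have hv' := Finset.mem_sdiff.1 (hT (Finset.mem_insert_self v T))
    obtain ⟨r, hr, hrv⟩ := hR v hv'.1
    obtain ⟨Q, hQ, hodd⟩ := hrv.exists_odd (fun h => hv'.2 (h ▸ hr))
    refine ⟨symmDiff P Q, (Finset.symmDiff_subset_union).trans (Finset.union_subset hP hQ), ?_⟩
    ext u
    have h1 := G.deg_symmDiff P Q u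
    have h2 := hodd u
    have h3 : u ∈ T ↔ u ∈ G.verts S \ R ∧ Odd (G.deg P u) := by rw [← hPT, Finset.mem_filter]
    have h4 : u ∈ G.verts S \ R → u ≠ r := fun hu h => (Finset.mem_sdiff.1 hu).2 (h ▸ hr)
    have h5 : u = v → u ∈ G.verts S \ R := fun h => h ▸ Finset.mem_sdiff.2 hv'
    have h6 : u = v → u ∉ T := fun h => h ▸ hv
    rw [Finset.mem_filter, Finset.mem_insert]
    have h7 : Odd (G.deg (symmDiff P Q) u) ↔ ¬ (Odd (G.deg P u) ↔ Odd (G.deg Q u)) := by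
      simp only [Nat.odd_iff]; omega
    rw [h7, h2, h3]
    clear h1 h2 h7 hPT hodd hrv hQ hP ih hT
    grind

theorem card_cyclics (S : Finset E) :
    ∃ k : ℕ, G.b1 S = k ∧ (G.cyclics S).card = 2 ^ k := by
  classical
  obtain ⟨R, hRs, hc, hR, hR'⟩ := G.exists_roots S
  set W := G.verts S \ R with hW
  set ψ : Finset E → Finset V := fun P => W.filter (fun v => Odd (G.deg P v)) with hψ
  have hker : ∀ P ⊆ S, (ψ P = ∅ ↔ G.IsCyclic P) := by
    intro P hP
    constructor
    · intro h v
      have hev : ∀ v ∈ W, Even (G.deg P v) := fun v hv => by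
        rw [← Nat.not_odd_iff_even]
        exact Finset.filter_eq_empty_iff.1 h hv
      by_cases hv : v ∈ G.verts S
      · by_cases hvR : v ∈ R
        · refine G.even_deg_of_forall_ne (U := Finset.univ.filter fun w => G.Reach S v w) (r := v)
            (Finset.mem_filter.2 ⟨Finset.mem_univ v, Relation.ReflTransGen.refl⟩) ?_ ?_
          · intro e he a b hab
            have : G.Reach S a b := Relation.ReflTransGen.single ⟨e, hP he, hab⟩
            simp only [Finset.mem_filter, Finset.mem_univ, true_and]
            exact ⟨fun h => h.trans this, fun h => h.trans this.symm⟩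
          · intro w hw hwv
            simp only [Finset.mem_filter, Finset.mem_univ, true_and] at hw
            by_cases hwS : w ∈ G.verts S
            · refine hev w (Finset.mem_sdiff.2 ⟨hwS, fun hwR => hwv ?_⟩)
              exact (hR' v hvR w hwR hw).symm
            · rw [G.deg_eq_zero fun h => hwS (verts_mono hP h)]; simp
        · exact hev v (Finset.mem_sdiff.2 ⟨hv, hvR⟩)
      · rw [G.deg_eq_zero fun h => hv (verts_mono hP h)]; simp
    · intro h
      exact Finset.filter_eq_empty_iff.2 fun v _ => Nat.not_odd_iff_even.2 (h v)
  have hadd : ∀ P Q, ψ (symmDiff P Q) = symmDiff (ψ P) (ψ Q) := by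
    intro P Q
    ext v
    have h1 := G.deg_symmDiff P Q v
    have h7 : Odd (G.deg (symmDiff P Q) v) ↔ ¬ (Odd (G.deg P v) ↔ Odd (G.deg Q v)) := by
      simp only [Nat.odd_iff]; omega
    simp only [hψ, Finset.mem_symmDiff, Finset.mem_filter, h7]
    tauto
  have hfib : ∀ T ∈ W.powerset,
      (S.powerset.filter fun P => ψ P = T).card = (G.cyclics S).card := by
    intro T hT
    obtain ⟨Q, hQ, hQT⟩ := G.exists_subset_odd S R hR T (Finset.mem_powerset.1 hT)
    change ψ Q = T at hQT
    have hsub : ∀ P ⊆ S, symmDiff P Q ⊆ S := fun P hP =>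
      Finset.symmDiff_subset_union.trans (Finset.union_subset hP hQ)
    refine Finset.card_bij' (fun P _ => symmDiff P Q) (fun P _ => symmDiff P Q) ?_ ?_ ?_ ?_
    · intro P hP
      rw [Finset.mem_filter, Finset.mem_powerset] at hP
      refine mem_cyclics.2 ⟨hsub P hP.1, ?_⟩
      rw [← hker _ (hsub P hP.1), hadd, hP.2, hQT, symmDiff_self]
      rfl
    · intro P hP
      rw [mem_cyclics] at hP
      rw [Finset.mem_filter, Finset.mem_powerset, hadd, (hker P hP.1).2 hP.2, hQT]
      exact ⟨hsub P hP.1, bot_symmDiff T⟩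
    · intro P _; exact symmDiff_symmDiff_cancel_right Q P
    · intro P _; exact symmDiff_symmDiff_cancel_right Q P
  have hcount : 2 ^ S.card = 2 ^ W.card * (G.cyclics S).card := by
    rw [← Finset.card_powerset, Finset.card_eq_sum_card_fiberwise (f := ψ) (t := W.powerset)
      (fun P _ => by
        rw [Finset.mem_coe, Finset.mem_powerset]; exact Finset.filter_subset _ _),
      Finset.sum_congr rfl hfib, Finset.sum_const, Finset.card_powerset, smul_eq_mul]
  have hpos : 0 < (G.cyclics S).card :=
    Finset.card_pos.2 ⟨∅, mem_cyclics.2 ⟨by simp, G.isCyclic_empty⟩⟩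
  have hle : W.card ≤ S.card := by
    rw [← Nat.pow_le_pow_iff_right (a := 2) (by norm_num), hcount]
    exact Nat.le_mul_of_pos_right _ hpos
  refine ⟨S.card - W.card, ?_, ?_⟩
  · have := Finset.card_sdiff_add_card_eq_card hRs
    rw [b1, ← hc, Nat.cast_sub hle]
    have : ((G.verts S \ R).card : ℤ) + R.card = (G.verts S).card := by exact_mod_cast this
    rw [hW]; linarith
  · have hs : S.card = W.card + (S.card - W.card) := by omega
    rw [hs, pow_add] at hcount
    exact (Nat.eq_of_mul_eq_mul_left (by positivity) hcount).symm

lemma exists_cyclic_nonempty {S : Finset E} (h : 1 ≤ G.b1 S) :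
    ∃ C ⊆ S, C.Nonempty ∧ G.IsCyclic C := by
  obtain ⟨k, hk, hc⟩ := G.card_cyclics S
  have hk1 : 1 ≤ k := by omega
  have : 1 < (G.cyclics S).card := by
    rw [hc]; exact Nat.one_lt_two_pow (by omega)
  obtain ⟨C, hC, hne⟩ := Finset.exists_mem_ne this ∅
  rw [mem_cyclics] at hC
  exact ⟨C, hC.1, Finset.nonempty_iff_ne_empty.2 hne, hC.2⟩

lemma exists_cyclic_ne {S : Finset E} (h : 2 ≤ G.b1 S) :
    ∃ C ⊆ S, C ≠ ∅ ∧ C ≠ S ∧ G.IsCyclic C := by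
  obtain ⟨k, hk, hc⟩ := G.card_cyclics S
  have hk1 : 2 ≤ k := by omega
  have h4 : 4 ≤ (G.cyclics S).card := by
    rw [hc]; exact Nat.pow_le_pow_right (n := 2) (by norm_num) hk1
  have h2 : ({∅, S} : Finset (Finset E)).card ≤ 2 := Finset.card_le_two
  obtain ⟨C, hC, hne⟩ := Finset.exists_mem_notMem_of_card_lt_card 
    (h2.trans_lt (lt_of_lt_of_le (by norm_num) h4))
  rw [mem_cyclics] at hC
  simp only [Finset.mem_insert, Finset.mem_singleton, not_or] at hne
  exact ⟨C, hC.1, hne.1, hne.2, hC.2⟩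

lemma one_le_b1 {S C : Finset E} (hCS : C ⊆ S) (hC : G.IsCyclic C) (hne : C.Nonempty) :
    1 ≤ G.b1 S := by
  obtain ⟨k, hk, hc⟩ := G.card_cyclics S
  by_contra hlt
  obtain rfl : k = 0 := by omega
  rw [pow_zero, Finset.card_eq_one] at hc
  obtain ⟨T, hT⟩ := hc
  have h1 : C ∈ G.cyclics S := mem_cyclics.2 ⟨hCS, hC⟩
  have h2 : ∅ ∈ G.cyclics S := mem_cyclics.2 ⟨by simp, G.isCyclic_empty⟩
  rw [hT, Finset.mem_singleton] at h1 h2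
  exact hne.ne_empty (h1.trans h2.symm)

lemma b1_union {S T : Finset E} (h : Disjoint S T) :
    G.b1 (S ∪ T) = G.b1 S + G.b1 T + (G.verts S ∩ G.verts T).card + G.ncomp (S ∪ T)
      - G.ncomp S - G.ncomp T := by
  have h1 := Finset.card_union_of_disjoint h
  have h2 := Finset.card_union_add_card_inter (G.verts S) (G.verts T)
  rw [b1, b1, b1, verts_union, h1]
  push_cast
  have h3 : (((G.verts S ∪ G.verts T).card : ℤ)) + (G.verts S ∩ G.verts T).card =
    (G.verts S).card + (G.verts T).card := by exact_mod_cast h2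
  linarith

lemma b1_add_le {S T : Finset E} (h : Disjoint S T) :
    G.b1 S + G.b1 T ≤ G.b1 (S ∪ T) := by
  obtain ⟨k, hk, hc⟩ := G.card_cyclics S
  obtain ⟨l, hl, hd⟩ := G.card_cyclics T
  obtain ⟨m, hm, he⟩ := G.card_cyclics (S ∪ T)
  have hle : (G.cyclics S ×ˢ G.cyclics T).card ≤ (G.cyclics (S ∪ T)).card := by
    refine Finset.card_le_card_of_injOn (fun P => P.1 ∪ P.2) ?_ ?_
    · rintro ⟨P, Q⟩ hPQ
      simp only [Finset.coe_product, Set.mem_prod, Finset.mem_coe, mem_cyclics] at hPQ ⊢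
      obtain ⟨⟨hP, hP'⟩, hQ, hQ'⟩ := hPQ
      exact ⟨Finset.union_subset_union hP hQ, hP'.union hQ' (h.mono hP hQ)⟩
    · rintro ⟨P, Q⟩ hPQ ⟨P', Q'⟩ hPQ' heq
      simp only [Finset.coe_product, Set.mem_prod, Finset.mem_coe, mem_cyclics] at hPQ hPQ'
      have hST := Finset.disjoint_left.1 h
      have hPS := hPQ.1.1
      have hQT := hPQ.2.1
      have hPS' := hPQ'.1.1
      have hQT' := hPQ'.2.1
      have hmem := Finset.ext_iff.1 heq
      simp only [Finset.mem_union] at hmem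
      clear hPQ hPQ' heq hk hl hm hc hd he
      rw [Prod.mk.injEq]
      constructor <;> ext x <;> have := hmem x <;> have := @hST x <;> have := @hPS x <;>
        have := @hQT x <;> have := @hPS' x <;> have := @hQT' x <;> tauto
  rw [Finset.card_product, hc, hd, he, ← pow_add, Nat.pow_le_pow_iff_right (by norm_num)] at hle
  rw [hk, hl, hm]
  exact_mod_cast hle

/-! ### Simple cycles -/

/-- A cyclic subgraph of first Betti number `1`. -/
def IsSimpleCycle (C : Finset E) : Prop := G.IsCyclic C ∧ G.b1 C = 1

variable {G}

lemma isSimpleCycle_of_forall {C : Finset E} (hC : G.IsCyclic C) (hne : C.Nonempty)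
    (h : ∀ S ⊆ C, G.IsCyclic S → S = ∅ ∨ S = C) : G.IsSimpleCycle C := by
  refine ⟨hC, le_antisymm ?_ (G.one_le_b1 subset_rfl hC hne)⟩
  by_contra hlt
  obtain ⟨S, hS, h1, h2, h3⟩ := G.exists_cyclic_ne (S := C) (by omega)
  exact (h S hS h3).elim h1 h2

namespace IsSimpleCycle

variable {C : Finset E}

lemma nonempty (hC : G.IsSimpleCycle C) : C.Nonempty := by
  obtain ⟨S, hS, hne, -⟩ := G.exists_cyclic_nonempty hC.2.ge
  exact hne.mono hS

lemma eq_empty_or_eq (hC : G.IsSimpleCycle C) {S : Finset E} (hS : S ⊆ C)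
    (hcyc : G.IsCyclic S) : S = ∅ ∨ S = C := by
  by_contra! h
  have h1 := G.one_le_b1 subset_rfl hcyc h.1
  have h2 := G.one_le_b1 subset_rfl (hcyc.sdiff hC.1 hS)
    (Finset.sdiff_nonempty.2 fun h' => h.2 (hS.antisymm h'))
  have h3 := G.b1_add_le (Finset.disjoint_sdiff : Disjoint S (C \ S))
  rw [Finset.union_sdiff_of_subset hS, hC.2] at h3
  omega

lemma ncomp_and_deg (hC : G.IsSimpleCycle C) :
    G.ncomp C = 1 ∧ ∀ v ∈ G.verts C, G.deg C v = 2 := by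
  have hdeg : ∀ v ∈ G.verts C, 2 ≤ G.deg C v := fun v hv => by
    have h1 := G.deg_pos_iff.2 hv
    have h2 := hC.1 v
    rw [Nat.even_iff] at h2
    omega
  have hsum := G.sum_deg (subset_refl (G.verts C))
  have hle := Finset.sum_le_sum hdeg
  rw [hsum, Finset.sum_const, smul_eq_mul] at hle
  have hpos := G.ncomp_pos hC.nonempty
  have hb := hC.2
  rw [b1] at hb
  refine ⟨by omega, fun v hv => ?_⟩
  have heq : ∑ v ∈ G.verts C, 2 = ∑ v ∈ G.verts C, G.deg C v := by
    rw [hsum, Finset.sum_const, smul_eq_mul]; omega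
  exact ((Finset.sum_eq_sum_iff_of_le hdeg).1 heq v hv).symm

lemma ncomp_eq (hC : G.IsSimpleCycle C) : G.ncomp C = 1 := hC.ncomp_and_deg.1

lemma deg_eq (hC : G.IsSimpleCycle C) {v : V} (hv : v ∈ G.verts C) : G.deg C v = 2 :=
  hC.ncomp_and_deg.2 v hv

end IsSimpleCycle

lemma b1_union_of_card_inter_le_one {S T : Finset E} (h : Disjoint S T) (hS : G.ncomp S = 1)
    (hT : G.ncomp T = 1) (hc : (G.verts S ∩ G.verts T).card ≤ 1) :
    G.b1 (S ∪ T) = G.b1 S + G.b1 T := by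
  refine le_antisymm ?_ (G.b1_add_le h)
  rw [G.b1_union h]
  have h1 := G.ncomp_union_le S T
  rcases Finset.eq_empty_or_nonempty (G.verts S ∩ G.verts T) with h0 | h0
  · rw [h0, Finset.card_empty]; omega
  · have := G.ncomp_union_le_of_inter hT h0
    omega

lemma ncomp_union_eq_one {S T : Finset E} (hne : T.Nonempty) (hS : G.ncomp S = 1)
    (hT : G.ncomp T = 1) (hc : (G.verts S ∩ G.verts T).Nonempty) : G.ncomp (S ∪ T) = 1 :=
  le_antisymm ((G.ncomp_union_le_of_inter hT hc).trans hS.le)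
    (G.ncomp_pos (hne.mono Finset.subset_union_right))

lemma IsSimpleCycle.b1_union_of_card_inter_eq_two {S T : Finset E} (hS : G.IsSimpleCycle S)
    (hT : G.IsSimpleCycle T) (h : Disjoint S T)
    (hc : (G.verts S ∩ G.verts T).card = 2) : G.b1 (S ∪ T) = 3 := by
  rw [G.b1_union h, ncomp_union_eq_one hT.nonempty hS.ncomp_eq hT.ncomp_eq
    (Finset.card_pos.1 (by omega)), hS.ncomp_eq, hT.ncomp_eq, hS.2, hT.2, hc]
  norm_num

/-- A simple cycle is the union of two arcs joining two given vertices;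
a third vertex lies on one of them. -/
lemma IsSimpleCycle.exists_arc {C : Finset E} (hC : G.IsSimpleCycle C) {x y z : V}
    (hx : x ∈ G.verts C) (hy : y ∈ G.verts C) (hz : z ∈ G.verts C) (hxy : x ≠ y) :
    ∃ P ⊆ C, (∀ u, Odd (G.deg P u) ↔ u = x ∨ u = y) ∧ z ∈ G.verts P := by
  obtain ⟨P, hP, hodd⟩ := (G.reach_of_ncomp_eq_one hC.ncomp_eq hx hy).exists_odd hxy
  by_cases hzP : z ∈ G.verts P
  · exact ⟨P, hP, hodd, hzP⟩
  · refine ⟨C \ P, Finset.sdiff_subset, fun u => ?_, ?_⟩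
    · have h1 := G.deg_sdiff hP u
      have h2 := hC.1 u
      rw [← hodd u, Nat.odd_iff, Nat.odd_iff]
      rw [Nat.even_iff] at h2
      omega
    · rw [← deg_pos_iff]
      have h1 := G.deg_sdiff hP z
      rw [G.deg_eq_zero hzP, hC.deg_eq hz] at h1
      omega

lemma IsSimpleCycle.eq_empty_of_subset_arc {C P S : Finset E} (hC : G.IsSimpleCycle C)
    (hP : P ⊆ C) {x : V} (hx : Odd (G.deg P x)) (hS : S ⊆ P) (hcyc : G.IsCyclic S) :
    S = ∅ := by
  refine (hC.eq_empty_or_eq (hS.trans hP) hcyc).resolve_right ?_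
  rintro rfl
  rw [hP.antisymm hS] at hx
  exact Nat.not_even_iff_odd.2 hx (hcyc x)

/-! ### Triangles of cycles -/

/-- Three edge-disjoint simple cycles which pairwise meet in three distinct single vertices. -/
structure IsTriangle (G : Multigraph V E) (A B C : Finset E) (p q r : V) : Prop where
  cycA : G.IsSimpleCycle A
  cycB : G.IsSimpleCycle B
  cycC : G.IsSimpleCycle C
  disjAB : Disjoint A B
  disjAC : Disjoint A C
  disjBC : Disjoint B C
  interAB : G.verts A ∩ G.verts B = {p}
  interAC : G.verts A ∩ G.verts C = {q}
  interBC : G.verts B ∩ G.verts C = {r}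
  p_ne_q : p ≠ q
  p_ne_r : p ≠ r
  q_ne_r : q ≠ r

/-- A minimal cyclic subgraph with first Betti number at least `4`, in a graph without cyclic
subgraphs of first Betti number `3`. -/
def IsMinimalLarge (G : Multigraph V E) (D : Finset E) : Prop :=
  G.IsCyclic D ∧ 4 ≤ G.b1 D ∧ ∀ C ⊆ D, C ≠ D → G.IsCyclic C → G.b1 C ≤ 2

lemma exists_isMinimalLarge (h3 : (3 : ℤ) ∉ G.B) {m : ℤ} (hm : m ∈ G.B) (hm3 : 3 < m) :
    ∃ D, G.IsMinimalLarge D := by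
  classical
  obtain ⟨D₀, hD₀, hb₀⟩ := hm
  obtain ⟨D, hD, hmin⟩ := Finset.exists_min_image
    (Finset.univ.filter fun D => G.IsCyclic D ∧ 4 ≤ G.b1 D) Finset.card
    ⟨D₀, by simp only [Finset.mem_filter, Finset.mem_univ, true_and]; exact ⟨hD₀, by omega⟩⟩
  simp only [Finset.mem_filter, Finset.mem_univ, true_and] at hD hmin
  refine ⟨D, hD.1, hD.2, fun C hC hne hcyc => ?_⟩
  by_contra hlt
  have h4 : G.b1 C ≠ 3 := fun h => h3 ⟨C, hcyc, h⟩
  exact (Finset.card_lt_card (hC.ssubset_of_ne hne)).not_ge (hmin C ⟨hcyc, by omega⟩)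

lemma two_le_card_inter {A B C : Finset E} (h4 : 4 ≤ G.b1 (A ∪ B ∪ C))
    (hAB : G.b1 (A ∪ B) = 2) (hC : G.IsSimpleCycle C) (hd : Disjoint (A ∪ B) C) :
    2 ≤ (G.verts (A ∪ B) ∩ G.verts C).card := by
  rw [G.b1_union hd, hAB, hC.2, hC.ncomp_eq] at h4
  have h1 := G.ncomp_union_le (A ∪ B) C
  rw [hC.ncomp_eq] at h1
  rcases Finset.eq_empty_or_nonempty (G.verts (A ∪ B) ∩ G.verts C) with h0 | h0
  · rw [h0, Finset.card_empty] at h4; omega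
  · have := G.ncomp_union_le_of_inter hC.ncomp_eq h0
    omega

/-- If the union of two simple cycles has first Betti number `2`, they meet at most once. -/
lemma card_inter_le_one {A B : Finset E} (hA : G.IsSimpleCycle A) (hB : G.IsSimpleCycle B)
    (hd : Disjoint A B) (h2 : G.b1 (A ∪ B) ≤ 2) : (G.verts A ∩ G.verts B).card ≤ 1 := by
  rw [G.b1_union hd, hA.2, hB.2, hA.ncomp_eq, hB.ncomp_eq] at h2
  have := G.ncomp_pos (hA.nonempty.mono (Finset.subset_union_left (s₂ := B)))
  omega

namespace IsMinimalLarge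

variable {D : Finset E}

lemma exists_isTriangle_of_partition (hD : G.IsMinimalLarge D) {A B C : Finset E}
    (hA : G.IsCyclic A) (hB : G.IsCyclic B) (hC : G.IsCyclic C) (neA : A.Nonempty)
    (neB : B.Nonempty) (neC : C.Nonempty) (hAB : Disjoint A B) (hAC : Disjoint A C)
    (hBC : Disjoint B C) (hu : A ∪ B ∪ C = D) : ∃ p q r, G.IsTriangle A B C p q r := by
  obtain ⟨-, h4, hmin⟩ := hD
  have key : ∀ X Y Z : Finset E, G.IsCyclic X → G.IsCyclic Y → G.IsCyclic Z → X.Nonempty →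
      Y.Nonempty → Z.Nonempty → Disjoint X Y → Disjoint X Z → Disjoint Y Z →
      X ∪ Y ∪ Z = D → G.b1 X = 1 ∧ G.b1 (X ∪ Y) = 2 := by
    intro X Y Z hX hY hZ neX neY neZ hXY hXZ hYZ hu
    have hle : G.b1 (X ∪ Y) ≤ 2 := by
      refine hmin _ (hu ▸ Finset.subset_union_left) (fun h => ?_) (hX.union hY hXY)
      obtain ⟨e, he⟩ := neZ
      have : e ∈ X ∪ Y := by rw [h, ← hu]; exact Finset.mem_union_right _ he
      rcases Finset.mem_union.1 this with h' | h'
      · exact Finset.disjoint_left.1 hXZ h' he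
      · exact Finset.disjoint_left.1 hYZ h' he
    have h1 := G.one_le_b1 subset_rfl hX neX
    have h2 := G.one_le_b1 subset_rfl hY neY
    have h3 := G.b1_add_le hXY
    omega
  have hu2 : A ∪ C ∪ B = D := by rw [← hu, Finset.union_right_comm]
  have hu3 : B ∪ C ∪ A = D := by rw [← hu, Finset.union_comm (B ∪ C), Finset.union_assoc]
  obtain ⟨bA, bAB⟩ := key A B C hA hB hC neA neB neC hAB hAC hBC hu
  obtain ⟨-, bAC⟩ := key A C B hA hC hB neA neC neB hAC hAB hBC.symm hu2
  obtain ⟨bB, bBC⟩ := key B C A hB hC hA neB neC neA hBC hAB.symm hAC.symm hu3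
  obtain ⟨bC, -⟩ := key C B A hC hB hA neC neB neA hBC.symm hAC.symm hAB.symm
    (by rw [← hu3, Finset.union_comm C])
  have sA : G.IsSimpleCycle A := ⟨hA, bA⟩
  have sB : G.IsSimpleCycle B := ⟨hB, bB⟩
  have sC : G.IsSimpleCycle C := ⟨hC, bC⟩
  have cAB := card_inter_le_one sA sB hAB bAB.le
  have cAC := card_inter_le_one sA sC hAC bAC.le
  have cBC := card_inter_le_one sB sC hBC bBC.le
  have tC := two_le_card_inter (hu ▸ h4) bAB sC (Finset.disjoint_union_left.2 ⟨hAC, hBC⟩)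
  have tB := two_le_card_inter (hu2 ▸ h4) bAC sB (Finset.disjoint_union_left.2 ⟨hAB, hBC.symm⟩)
  have tA := two_le_card_inter (hu3 ▸ h4) bBC sA
    (Finset.disjoint_union_left.2 ⟨hAB.symm, hAC.symm⟩)
  rw [verts_union, Finset.union_inter_distrib_right] at tA tB tC
  have uC := Finset.card_union_add_card_inter (G.verts A ∩ G.verts C) (G.verts B ∩ G.verts C)
  have uB := Finset.card_union_add_card_inter (G.verts A ∩ G.verts B) (G.verts C ∩ G.verts B)
  have uA := Finset.card_union_add_card_inter (G.verts B ∩ G.verts A) (G.verts C ∩ G.verts A)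
  rw [Finset.inter_comm (G.verts C) (G.verts B)] at uB tB
  rw [Finset.inter_comm (G.verts B) (G.verts A), Finset.inter_comm (G.verts C) (G.verts A)]
    at uA tA
  obtain ⟨p, hp⟩ := Finset.card_eq_one.1 (by omega : (G.verts A ∩ G.verts B).card = 1)
  obtain ⟨q, hq⟩ := Finset.card_eq_one.1 (by omega : (G.verts A ∩ G.verts C).card = 1)
  obtain ⟨r, hr⟩ := Finset.card_eq_one.1 (by omega : (G.verts B ∩ G.verts C).card = 1)
  rw [hp, hq] at tA
  rw [hp, hr] at tB
  rw [hq, hr] at tC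
  refine ⟨p, q, r, sA, sB, sC, hAB, hAC, hBC, hp, hq, hr, ?_, ?_, ?_⟩ <;> rintro rfl <;> simp_all

/-- A nonempty cyclic subgraph avoiding a given vertex of valency at most `4`. -/
lemma exists_cyclic_avoiding (h4 : 4 ≤ G.b1 D) {v : V} (hv : G.deg D v ≤ 4) :
    ∃ S ⊆ D, S.Nonempty ∧ G.IsCyclic S ∧ G.deg S v = 0 := by
  classical
  set st := D.filter fun e => v ∈ G.ends e with hst
  have hdeg : ∀ S ⊆ D, G.deg S v = ∑ e ∈ S ∩ st, G.inc e v := by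
    intro S hS
    rw [deg_eq_sum_inc]
    refine (Finset.sum_subset Finset.inter_subset_left fun e he hne => ?_).symm
    by_contra h0
    exact hne (Finset.mem_inter.2 ⟨he, Finset.mem_filter.2
      ⟨hS he, G.inc_pos_iff.1 (Nat.pos_of_ne_zero h0)⟩⟩)
  have hpos : ∀ e ∈ st, 1 ≤ G.inc e v := fun e he =>
    G.inc_pos_iff.2 (Finset.mem_filter.1 he).2
  have hstD : st ⊆ D := Finset.filter_subset _ _
  have hT : ∃ T ⊆ st, T.card ≤ 3 ∧ ∀ S ⊆ D, G.IsCyclic S → S ∩ T = ∅ → G.deg S v = 0 := by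
    by_cases hcard : st.card ≤ 3
    · refine ⟨st, subset_rfl, hcard, fun S hS _ h => ?_⟩
      rw [hdeg S hS, h, Finset.sum_empty]
    · have hsum : ∑ e ∈ st, G.inc e v ≤ 4 := by
        have := hdeg D subset_rfl
        rw [Finset.inter_eq_right.2 hstD] at this
        omega
      obtain ⟨f, hf⟩ := Finset.card_pos.1 (by omega : 0 < st.card)
      refine ⟨st.erase f, Finset.erase_subset _ _, ?_, fun S hS hcyc h => ?_⟩
      · have h1 := Finset.sum_le_sum hpos
        rw [Finset.sum_const, smul_eq_mul, mul_one] at h1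
        rw [Finset.card_erase_of_mem hf]
        omega
      · have hsub : S ∩ st ⊆ {f} := fun e he => by
          by_contra hne
          have : e ∈ S ∩ st.erase f := by
            rw [Finset.mem_inter, Finset.mem_erase]
            exact ⟨(Finset.mem_inter.1 he).1, by simpa using hne, (Finset.mem_inter.1 he).2⟩
          rw [h] at this
          simp at this
        have h1 : G.inc f v ≤ 1 := by
          have h1 := Finset.sum_le_sum fun e (he : e ∈ st.erase f) =>
            hpos e (Finset.mem_of_mem_erase he)
          rw [Finset.sum_const, smul_eq_mul, mul_one, Finset.card_erase_of_mem hf] at h1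
          have h2 := Finset.add_sum_erase st (fun e => G.inc e v) hf
          omega
        have h2 : G.deg S v ≤ 1 := by
          rw [hdeg S hS]
          refine (Finset.sum_le_sum_of_subset hsub).trans ?_
          rwa [Finset.sum_singleton]
        have h3 := hcyc v
        rw [Nat.even_iff] at h3
        omega
  obtain ⟨T, hTst, hTc, hT⟩ := hT
  obtain ⟨k, hk, hc⟩ := G.card_cyclics D
  have hlt : T.powerset.card < (G.cyclics D).card := by
    rw [Finset.card_powerset, hc]
    exact Nat.pow_lt_pow_right (by norm_num) (by omega)
  obtain ⟨P, hP, Q, hQ, hne, heq⟩ := Finset.exists_ne_map_eq_of_card_lt_of_maps_to hlt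
    (f := fun S => S ∩ T) fun S _ => by
      rw [Finset.mem_coe, Finset.mem_powerset]; exact Finset.inter_subset_right
  rw [mem_cyclics] at hP hQ
  have hsub : symmDiff P Q ⊆ D :=
    Finset.symmDiff_subset_union.trans (Finset.union_subset hP.1 hQ.1)
  refine ⟨symmDiff P Q, hsub, ?_, hP.2.symmDiff hQ.2, hT _ hsub (hP.2.symmDiff hQ.2) ?_⟩
  · rw [Finset.nonempty_iff_ne_empty]
    exact fun h => hne (symmDiff_eq_bot.1 h)
  · ext e
    have := Finset.ext_iff.1 heq e
    simp only [Finset.mem_inter, Finset.mem_symmDiff, Finset.notMem_empty] at this ⊢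
    tauto

theorem exists_isTriangle (hD : G.IsMinimalLarge D) :
    ∃ A B C p q r, G.IsTriangle A B C p q r ∧ A ∪ B ∪ C = D := by
  obtain ⟨hcyc, h4, hmin⟩ := id hD
  by_cases hsplit : ∃ C ⊆ D, C ≠ D ∧ G.IsCyclic C ∧ 2 ≤ G.b1 C
  · obtain ⟨C, hC, hne, hCc, hb⟩ := hsplit
    obtain ⟨A, hA, hA0, hAC, hAc⟩ := G.exists_cyclic_ne hb
    have hu : A ∪ C \ A ∪ D \ C = D := by
      rw [Finset.union_sdiff_of_subset hA, Finset.union_sdiff_of_subset hC]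
    obtain ⟨p, q, r, h⟩ := hD.exists_isTriangle_of_partition hAc (hAc.sdiff hCc hA)
      (hCc.sdiff hcyc hC) (Finset.nonempty_iff_ne_empty.2 hA0)
      (Finset.sdiff_nonempty.2 fun h => hAC (hA.antisymm h))
      (Finset.sdiff_nonempty.2 fun h => hne (hC.antisymm h)) Finset.disjoint_sdiff
      (Finset.disjoint_sdiff.mono_left hA)
      (Finset.disjoint_sdiff.mono_left Finset.sdiff_subset) hu
    exact ⟨A, C \ A, D \ C, p, q, r, h, hu⟩
  · exfalso
    push Not at hsplit
    have hsimple : ∀ C ⊆ D, C ≠ D → C.Nonempty → G.IsCyclic C → G.IsSimpleCycle C :=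
      fun C hC hne h0 hc => ⟨hc, by
        have := hsplit C hC hne hc
        have := G.one_le_b1 subset_rfl hc h0
        omega⟩
    have hcompl : ∀ C ⊆ D, C ≠ D → C.Nonempty → G.IsCyclic C → G.IsSimpleCycle (D \ C) := by
      intro C hC hne h0 hc
      refine hsimple _ Finset.sdiff_subset (fun h => ?_)
        (Finset.sdiff_nonempty.2 fun h => hne (hC.antisymm h)) (hc.sdiff hcyc hC)
      obtain ⟨e, he⟩ := h0
      have := hC he
      rw [← h] at this
      exact (Finset.mem_sdiff.1 this).2 he
    obtain ⟨C, hC, h0, hne, hc⟩ := G.exists_cyclic_ne (S := D) (by omega)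
    have sC := hsimple C hC hne (Finset.nonempty_iff_ne_empty.2 h0) hc
    have sC' := hcompl C hC hne (Finset.nonempty_iff_ne_empty.2 h0) hc
    have hb := G.b1_union (Finset.disjoint_sdiff : Disjoint C (D \ C))
    have hn := G.ncomp_union_le C (D \ C)
    rw [sC.2, sC'.2, sC.ncomp_eq, sC'.ncomp_eq, Finset.union_sdiff_of_subset hC] at hb
    rw [sC.ncomp_eq, sC'.ncomp_eq, Finset.union_sdiff_of_subset hC] at hn
    obtain ⟨v, hv⟩ := Finset.card_pos.1 (by omega : 0 < (G.verts C ∩ G.verts (D \ C)).card)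
    rw [Finset.mem_inter] at hv
    have hdeg := G.deg_sdiff hC v
    rw [sC.deg_eq hv.1, sC'.deg_eq hv.2] at hdeg
    obtain ⟨S, hS, hS0, hSc, hSv⟩ := exists_cyclic_avoiding h4 hdeg.ge
    have hSD : S ≠ D := by rintro rfl; omega
    have sS := hcompl S hS hSD hS0 hSc
    have h1 := G.deg_sdiff hS v
    have h2 := sS.deg_eq (v := v) (G.deg_pos_iff.1 (by omega))
    omega

end IsMinimalLarge

namespace IsTriangle

variable {A B C D : Finset E} {p q r : V}

lemma swapAB (h : G.IsTriangle A B C p q r) : G.IsTriangle B A C p r q :=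
  ⟨h.cycB, h.cycA, h.cycC, h.disjAB.symm, h.disjBC, h.disjAC,
    Finset.inter_comm (G.verts A) _ ▸ h.interAB, h.interBC, h.interAC,
    h.p_ne_r, h.p_ne_q, h.q_ne_r.symm⟩

lemma swapBC (h : G.IsTriangle A B C p q r) : G.IsTriangle A C B q p r :=
  ⟨h.cycA, h.cycC, h.cycB, h.disjAC, h.disjAB, h.disjBC.symm, h.interAC, h.interAB,
    Finset.inter_comm (G.verts B) _ ▸ h.interBC, h.p_ne_q.symm, h.q_ne_r, h.p_ne_r⟩

lemma mem_interAB (h : G.IsTriangle A B C p q r) {v : V} :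
    v ∈ G.verts A ∧ v ∈ G.verts B ↔ v = p := by
  rw [← Finset.mem_inter, h.interAB, Finset.mem_singleton]

lemma mem_interAC (h : G.IsTriangle A B C p q r) {v : V} :
    v ∈ G.verts A ∧ v ∈ G.verts C ↔ v = q := h.swapBC.mem_interAB

lemma mem_interBC (h : G.IsTriangle A B C p q r) {v : V} :
    v ∈ G.verts B ∧ v ∈ G.verts C ↔ v = r := h.swapAB.mem_interAC

lemma ncomp_union (h : G.IsTriangle A B C p q r) : G.ncomp (A ∪ B) = 1 :=
  ncomp_union_eq_one h.cycB.nonempty h.cycA.ncomp_eq h.cycB.ncomp_eq ⟨p, by simp [h.interAB]⟩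

lemma b1_union (h : G.IsTriangle A B C p q r) : G.b1 (A ∪ B) = 2 := by
  rw [b1_union_of_card_inter_le_one h.disjAB h.cycA.ncomp_eq h.cycB.ncomp_eq
    (by simp [h.interAB]), h.cycA.2, h.cycB.2]
  norm_num

lemma verts_union_inter (h : G.IsTriangle A B C p q r) :
    G.verts (A ∪ B) ∩ G.verts C = {q, r} := by
  rw [verts_union, Finset.union_inter_distrib_right, h.interAC, h.interBC]
  rfl

lemma disjoint_union (h : G.IsTriangle A B C p q r) : Disjoint (A ∪ B) C :=
  Finset.disjoint_union_left.2 ⟨h.disjAC, h.disjBC⟩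

lemma b1_union_union (h : G.IsTriangle A B C p q r) : G.b1 (A ∪ B ∪ C) = 4 := by
  have hne : (G.verts (A ∪ B) ∩ G.verts C).Nonempty := ⟨q, by simp [h.verts_union_inter]⟩
  rw [G.b1_union h.disjoint_union, h.b1_union, h.cycC.2, h.ncomp_union, h.cycC.ncomp_eq,
    h.verts_union_inter, Finset.card_pair h.q_ne_r,
    ncomp_union_eq_one h.cycC.nonempty h.ncomp_union h.cycC.ncomp_eq hne]
  norm_num

/-- Two arcs on different cycles of a triangle form an acyclic subgraph. -/
lemma eq_empty_of_subset_arcs (h : G.IsTriangle A B C p q r) {P Q S : Finset E} (hP : P ⊆ A)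
    (hQ : Q ⊆ B) {x y : V} (hx : Odd (G.deg P x)) (hy : Odd (G.deg Q y)) (hS : S ⊆ P ∪ Q)
    (hcyc : G.IsCyclic S) : S = ∅ := by
  have hAB := Finset.disjoint_left.1 h.disjAB
  have hSA : G.IsCyclic (S ∩ A) := by
    refine G.isCyclic_of_forall_ne p fun v hv => ?_
    by_cases hvB : v ∈ G.verts B
    · rw [G.deg_eq_zero fun hvA => hv (h.mem_interAB.1
        ⟨verts_mono Finset.inter_subset_right hvA, hvB⟩)]
      simp
    · have h1 := G.deg_sdiff (Finset.inter_subset_left : S ∩ A ⊆ S) v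
      have h2 : S \ (S ∩ A) ⊆ B := fun e he => by
        simp only [Finset.mem_sdiff, Finset.mem_inter, not_and] at he
        rcases Finset.mem_union.1 (hS he.1) with h' | h'
        · exact absurd (hP h') (he.2 he.1)
        · exact hQ h'
      rw [G.deg_eq_zero fun hv => hvB (verts_mono h2 hv), zero_add] at h1
      exact h1 ▸ hcyc v
  have hSA0 : S ∩ A = ∅ := by
    refine h.cycA.eq_empty_of_subset_arc hP hx (fun e he => ?_) hSA
    rw [Finset.mem_inter] at he
    exact (Finset.mem_union.1 (hS he.1)).resolve_right fun h' => hAB he.2 (hQ h')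
  refine h.cycB.eq_empty_of_subset_arc hQ hy (fun e he => ?_) hcyc
  refine (Finset.mem_union.1 (hS he)).resolve_left fun h' => ?_
  have : e ∈ S ∩ A := Finset.mem_inter.2 ⟨he, hP h'⟩
  simp [hSA0] at this

end IsTriangle

/-! ### Cycles relative to a subgraph -/

/-- A minimal nonempty subgraph, edge-disjoint from `D`, with even valencies outside `D`. -/
structure IsRelCycle (G : Multigraph V E) (D K : Finset E) : Prop where
  disj : Disjoint K D
  nonempty : K.Nonempty
  even : ∀ v ∉ G.verts D, Even (G.deg K v)
  sum_deg_le : ∑ v ∈ G.verts D, G.deg K v ≤ 2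
  eq_empty_or_eq : ∀ S ⊆ K, (∀ v ∉ G.verts D, Even (G.deg S v)) → S = ∅ ∨ S = K

/-- A relative cycle joining two distinct vertices of `D`. -/
structure IsEar (G : Multigraph V E) (D K : Finset E) (x y : V) : Prop
    extends G.IsRelCycle D K where
  ne : x ≠ y
  odd_iff : ∀ u, Odd (G.deg K u) ↔ u = x ∨ u = y
  inter : G.verts K ∩ G.verts D = {x, y}

namespace IsRelCycle

variable {D K : Finset E}

lemma isSimpleCycle_union (h : G.IsRelCycle D K) {Q : Finset E} (hQ : Q ⊆ D)
    (hcyc : G.IsCyclic (K ∪ Q)) (hQ0 : ∀ S ⊆ Q, G.IsCyclic S → S = ∅) :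
    G.IsSimpleCycle (K ∪ Q) := by
  refine isSimpleCycle_of_forall hcyc (h.nonempty.mono Finset.subset_union_left) fun S hS hSc => ?_
  have hev : ∀ v ∉ G.verts D, Even (G.deg (S ∩ K) v) := fun v hv => by
    have h1 := G.deg_sdiff (Finset.inter_subset_left : S ∩ K ⊆ S) v
    have h2 : S \ (S ∩ K) ⊆ D := fun e he => by
      simp only [Finset.mem_sdiff, Finset.mem_inter, not_and] at he
      exact hQ ((Finset.mem_union.1 (hS he.1)).resolve_left (he.2 he.1))
    rw [G.deg_eq_zero fun hv' => hv (verts_mono h2 hv'), zero_add] at h1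
    exact h1 ▸ hSc v
  rcases h.eq_empty_or_eq (S ∩ K) Finset.inter_subset_right hev with h0 | h0
  · refine Or.inl (hQ0 S (fun e he => ?_) hSc)
    refine (Finset.mem_union.1 (hS he)).resolve_left fun h' => ?_
    have : e ∈ S ∩ K := Finset.mem_inter.2 ⟨he, h'⟩
    simp [h0] at this
  · right
    have h1 := hQ0 ((K ∪ Q) \ S) (fun e he => ?_) (hSc.sdiff hcyc hS)
    · exact hS.antisymm (Finset.sdiff_eq_empty_iff_subset.1 h1)
    · rw [Finset.mem_sdiff] at he
      refine (Finset.mem_union.1 he.1).resolve_left fun h' => he.2 ?_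
      rw [← h0] at h'
      exact (Finset.mem_inter.1 h').1

/-- A relative cycle is a simple cycle meeting `D` at most once, or an ear. -/
lemma isSimpleCycle_or_isEar (h : G.IsRelCycle D K) :
    (G.IsSimpleCycle K ∧ (G.verts K ∩ G.verts D).card ≤ 1) ∨ ∃ x y, G.IsEar D K x y := by
  have hpos : ∀ v ∈ G.verts K ∩ G.verts D, 1 ≤ G.deg K v := fun v hv =>
    G.deg_pos_iff.2 (Finset.mem_inter.1 hv).1
  have hle : ∑ v ∈ G.verts K ∩ G.verts D, G.deg K v ≤ 2 :=
    (Finset.sum_le_sum_of_subset Finset.inter_subset_right).trans h.sum_deg_le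
  by_cases hcyc : G.IsCyclic K
  · refine Or.inl ⟨?_, ?_⟩
    · have := h.isSimpleCycle_union (Finset.empty_subset D) (by rwa [Finset.union_empty])
        fun S hS _ => Finset.subset_empty.1 hS
      rwa [Finset.union_empty] at this
    · have h2 : ∀ v ∈ G.verts K ∩ G.verts D, 2 ≤ G.deg K v := fun v hv => by
        have h1 := hpos v hv
        have h2 := hcyc v
        rw [Nat.even_iff] at h2
        omega
      have := Finset.sum_le_sum h2
      rw [Finset.sum_const, smul_eq_mul] at this
      omega
  · right
    have hodd : ∀ v, Odd (G.deg K v) → v ∈ G.verts K ∩ G.verts D := fun v hv => by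
      refine Finset.mem_inter.2 ⟨G.deg_pos_iff.1 hv.pos, ?_⟩
      by_contra hvD
      exact Nat.not_even_iff_odd.2 hv (h.even v hvD)
    have hx : ∃ x, Odd (G.deg K x) := by
      by_contra! h0
      exact hcyc fun v => Nat.not_odd_iff_even.1 (h0 v)
    obtain ⟨x, hx⟩ := hx
    have hy : ∃ y, y ≠ x ∧ Odd (G.deg K y) := by
      by_contra! h0
      exact Nat.not_even_iff_odd.2 hx
        (G.isCyclic_of_forall_ne x (fun v hv => Nat.not_odd_iff_even.1 (h0 v hv)) x)
    obtain ⟨y, hyx, hy⟩ := hy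
    have hinter : G.verts K ∩ G.verts D = {x, y} := by
      refine (Finset.eq_of_subset_of_card_le ?_ ?_).symm
      · intro v hv
        rw [Finset.mem_insert, Finset.mem_singleton] at hv
        rcases hv with rfl | rfl
        · exact hodd _ hx
        · exact hodd _ hy
      · have := Finset.sum_le_sum hpos
        rw [Finset.sum_const, smul_eq_mul, mul_one] at this
        rw [Finset.card_pair hyx.symm]
        omega
    refine ⟨x, y, h, hyx.symm, fun u => ⟨fun hu => ?_, ?_⟩, hinter⟩
    · have := hodd u hu
      rwa [hinter, Finset.mem_insert, Finset.mem_singleton] at this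
    · rintro (rfl | rfl) <;> assumption

end IsRelCycle

namespace IsEar

variable {A B C D K : Finset E} {p q r x y : V}

lemma three_mem_of_mem_of_mem (hK : G.IsEar D K x y) (h : G.IsTriangle A B C p q r)
    (hu : A ∪ B ∪ C = D) (hx : x ∈ G.verts A) (hy : y ∈ G.verts B) (hxp : x ≠ p) (hyp : y ≠ p) :
    (3 : ℤ) ∈ G.B := by
  obtain ⟨pA, pB⟩ := h.mem_interAB.2 rfl
  obtain ⟨qA, qC⟩ := h.mem_interAC.2 rfl
  obtain ⟨rB, rC⟩ := h.mem_interBC.2 rfl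
  obtain ⟨P, hP, oddP, hqP⟩ := h.cycA.exists_arc hx pA qA hxp
  obtain ⟨Q, hQ, oddQ, hrQ⟩ := h.cycB.exists_arc hy pB rB hyp
  have hPQ : Disjoint P Q := h.disjAB.mono hP hQ
  have hPQAB : P ∪ Q ⊆ A ∪ B := Finset.union_subset_union hP hQ
  have hABD : A ∪ B ⊆ D := hu ▸ Finset.subset_union_left
  have hCD : C ⊆ D := hu ▸ Finset.subset_union_right
  have hKPQ : Disjoint K (P ∪ Q) := hK.disj.mono_right (hPQAB.trans hABD)
  have hcyc : G.IsCyclic (K ∪ (P ∪ Q)) := fun u => by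
    rw [G.deg_union hKPQ, G.deg_union hPQ, Nat.even_add, Nat.even_add]
    simp only [← Nat.not_odd_iff_even, hK.odd_iff, oddP, oddQ]
    have := hK.ne
    grind
  have hL := hK.isSimpleCycle_union (hPQAB.trans hABD) hcyc fun S hS hSc =>
    h.eq_empty_of_subset_arcs hP hQ ((oddP x).2 (Or.inl rfl)) ((oddQ y).2 (Or.inl rfl)) hS hSc
  have hLC : Disjoint (K ∪ (P ∪ Q)) C :=
    Finset.disjoint_union_left.2 ⟨hK.disj.mono_right hCD, h.disjoint_union.mono_left hPQAB⟩
  have hinter : G.verts (K ∪ (P ∪ Q)) ∩ G.verts C = {q, r} := by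
    apply Finset.Subset.antisymm
    · intro v hv
      rw [← h.verts_union_inter, verts_union]
      simp only [verts_union, Finset.mem_inter, Finset.mem_union] at hv ⊢
      obtain ⟨hvK | hvP | hvQ, hvC⟩ := hv
      · have : v ∈ G.verts K ∩ G.verts D := Finset.mem_inter.2 ⟨hvK, verts_mono hCD hvC⟩
        rw [hK.inter, Finset.mem_insert, Finset.mem_singleton] at this
        rcases this with rfl | rfl
        · exact ⟨Or.inl hx, hvC⟩
        · exact ⟨Or.inr hy, hvC⟩
      · exact ⟨Or.inl (verts_mono hP hvP), hvC⟩
      · exact ⟨Or.inr (verts_mono hQ hvQ), hvC⟩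
    · intro v hv
      simp only [verts_union, Finset.mem_insert, Finset.mem_singleton, Finset.mem_inter,
        Finset.mem_union] at hv ⊢
      rcases hv with rfl | rfl
      · exact ⟨Or.inr (Or.inl hqP), qC⟩
      · exact ⟨Or.inr (Or.inr hrQ), rC⟩
  exact ⟨_, hcyc.union h.cycC.1 hLC, hL.b1_union_of_card_inter_eq_two h.cycC hLC
    (by rw [hinter, Finset.card_pair h.q_ne_r])⟩

lemma mem_verts_of_arc (hK : G.IsEar D K x y) (h : G.IsTriangle A B C p q r)
    (h3 : (3 : ℤ) ∉ G.B) (hu : A ∪ B ∪ C = D) (hx : x ∈ G.verts C) (hy : y ∈ G.verts C)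
    {P : Finset E} (hP : P ⊆ C) (hodd : ∀ u, Odd (G.deg P u) ↔ u = x ∨ u = y) :
    q ∈ G.verts P ∧ r ∈ G.verts P := by
  have hABD : A ∪ B ⊆ D := hu ▸ Finset.subset_union_left
  have hCD : C ⊆ D := hu ▸ Finset.subset_union_right
  have hKP : Disjoint K P := hK.disj.mono_right (hP.trans hCD)
  have hcyc : G.IsCyclic (K ∪ P) := fun u => by
    rw [G.deg_union hKP, Nat.even_add, ← Nat.not_odd_iff_even, ← Nat.not_odd_iff_even,
      hK.odd_iff, hodd]
  have hL := hK.isSimpleCycle_union (hP.trans hCD) hcyc fun S hS hSc =>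
    h.cycC.eq_empty_of_subset_arc hP ((hodd x).2 (Or.inl rfl)) hS hSc
  have hd : Disjoint (A ∪ B) (K ∪ P) :=
    Finset.disjoint_union_right.2 ⟨(hK.disj.mono_right hABD).symm, h.disjoint_union.mono_right hP⟩
  have hc : ¬ (G.verts (A ∪ B) ∩ G.verts (K ∪ P)).card ≤ 1 := fun hc => by
    refine h3 ⟨_, (h.cycA.1.union h.cycB.1 h.disjAB).union hcyc hd, ?_⟩
    rw [b1_union_of_card_inter_le_one hd h.ncomp_union hL.ncomp_eq hc, h.b1_union, hL.2]
    norm_num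
  have hmem : ∀ u, u = x ∨ u = y → u ∈ G.verts P := fun u hu =>
    G.deg_pos_iff.1 ((hodd u).2 hu).pos
  have hsub : G.verts (A ∪ B) ∩ G.verts (K ∪ P) ⊆ {q, r} ∩ G.verts P := by
    intro v hv
    rw [← h.verts_union_inter]
    rw [G.verts_union K P] at hv
    simp only [Finset.mem_inter, Finset.mem_union] at hv ⊢
    obtain ⟨hvAB, hvK | hvP⟩ := hv
    · have : v ∈ G.verts K ∩ G.verts D := Finset.mem_inter.2 ⟨hvK, verts_mono hABD hvAB⟩
      rw [hK.inter, Finset.mem_insert, Finset.mem_singleton] at this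
      exact ⟨⟨hvAB, by rcases this with rfl | rfl <;> assumption⟩, hmem v this⟩
    · exact ⟨⟨hvAB, verts_mono hP hvP⟩, hvP⟩
  have heq : {q, r} ∩ G.verts P = {q, r} := by
    refine Finset.eq_of_subset_of_card_le Finset.inter_subset_left ?_
    have := Finset.card_le_card hsub
    have : ({q, r} : Finset V).card ≤ 2 := Finset.card_le_two
    omega
  rw [Finset.inter_eq_left, Finset.insert_subset_iff, Finset.singleton_subset_iff] at heq
  exact heq

lemma three_mem_of_mem_same (hK : G.IsEar D K x y) (h : G.IsTriangle A B C p q r)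
    (hu : A ∪ B ∪ C = D) (hx : x ∈ G.verts C) (hy : y ∈ G.verts C) : (3 : ℤ) ∈ G.B := by
  by_contra h3
  obtain ⟨qA, qC⟩ := h.mem_interAC.2 rfl
  obtain ⟨rB, rC⟩ := h.mem_interBC.2 rfl
  obtain ⟨P, hP, hodd, -⟩ := h.cycC.exists_arc hx hy qC hK.ne
  have hodd' : ∀ u, Odd (G.deg (C \ P) u) ↔ u = x ∨ u = y := fun u => by
    have h1 := G.deg_sdiff hP u
    have h2 := h.cycC.1 u
    rw [← hodd u, Nat.odd_iff, Nat.odd_iff]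
    rw [Nat.even_iff] at h2
    omega
  have h1 := hK.mem_verts_of_arc h h3 hu hx hy hP hodd
  have h2 := hK.mem_verts_of_arc h h3 hu hx hy Finset.sdiff_subset hodd'
  have key : ∀ v ∈ G.verts C, v ∈ G.verts P → v ∈ G.verts (C \ P) → v = x ∨ v = y := by
    intro v hv hvP hvQ
    rw [← deg_pos_iff] at hvP hvQ
    have hs := G.deg_sdiff hP v
    rw [h.cycC.deg_eq hv] at hs
    rw [← hodd, Nat.odd_iff]
    omega
  have hne := hK.ne
  have hqr := h.q_ne_r
  rcases key q qC h1.1 h2.1 with rfl | rfl <;> rcases key r rC h1.2 h2.2 with rfl | rfl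
  · exact hqr rfl
  · exact h3 (hK.three_mem_of_mem_of_mem h hu qA rB h.p_ne_q.symm h.p_ne_r.symm)
  · exact h3 (hK.three_mem_of_mem_of_mem h.swapAB (by rw [← hu, Finset.union_comm B]) rB qA
      h.p_ne_r.symm h.p_ne_q.symm)
  · exact hqr rfl

theorem three_mem (hK : G.IsEar D K x y) (h : G.IsTriangle A B C p q r)
    (hu : A ∪ B ∪ C = D) : (3 : ℤ) ∈ G.B := by
  have key : ∀ {A B C : Finset E} {p q r : V}, G.IsTriangle A B C p q r → A ∪ B ∪ C = D →
      x ∈ G.verts A → y ∈ G.verts A ∪ G.verts B → (3 : ℤ) ∈ G.B := by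
    intro A B C p q r h hu hx hy
    have hA : y ∈ G.verts A → (3 : ℤ) ∈ G.B := fun hy =>
      hK.three_mem_of_mem_same h.swapBC.swapAB.swapBC
        (by rw [← hu, Finset.union_comm C, Finset.union_comm, Finset.union_assoc]) hx hy
    rcases Finset.mem_union.1 hy with hy | hy
    · exact hA hy
    by_cases hxp : x = p
    · exact hK.three_mem_of_mem_same h.swapBC
        (by rw [← hu, Finset.union_right_comm]) (hxp ▸ (h.mem_interAB.2 rfl).2) hy
    by_cases hyp : y = p
    · exact hA (hyp ▸ (h.mem_interAB.2 rfl).1)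
    · exact hK.three_mem_of_mem_of_mem h hu hx hy hxp hyp
  have hD : G.verts D = G.verts A ∪ G.verts B ∪ G.verts C := by
    rw [← hu, verts_union, verts_union]
  have hxy : ∀ v, v = x ∨ v = y → v ∈ G.verts A ∪ G.verts B ∪ G.verts C := fun v hv => by
    rw [← hD]
    refine (Finset.mem_inter.1 (?_ : v ∈ G.verts K ∩ G.verts D)).2
    rw [hK.inter]; simpa using hv
  have hx := hxy x (Or.inl rfl)
  have hy := hxy y (Or.inr rfl)
  simp only [Finset.mem_union] at hx hy key
  have h2 : A ∪ C ∪ B = D := by rw [← hu, Finset.union_right_comm]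
  have h3 : B ∪ A ∪ C = D := by rw [← hu, Finset.union_comm B]
  have h4 : B ∪ C ∪ A = D := by rw [← h3, Finset.union_right_comm]
  have h5 : C ∪ A ∪ B = D := by rw [← h2, Finset.union_comm C]
  have h6 : C ∪ B ∪ A = D := by rw [← h4, Finset.union_comm C]
  rcases hx with (hx | hx) | hx <;> rcases hy with (hy | hy) | hy
  · exact key h hu hx (Or.inl hy)
  · exact key h hu hx (Or.inr hy)
  · exact key h.swapBC h2 hx (Or.inr hy)
  · exact key h.swapAB h3 hx (Or.inr hy)
  · exact key h.swapAB h3 hx (Or.inl hy)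
  · exact key h.swapAB.swapBC h4 hx (Or.inr hy)
  · exact key h.swapBC.swapAB h5 hx (Or.inr hy)
  · exact key h.swapBC.swapAB.swapBC h6 hx (Or.inr hy)
  · exact key h.swapBC.swapAB h5 hx (Or.inl hy)

end IsEar

theorem IsRelCycle.three_mem {A B C K : Finset E} {p q r : V} (hK : G.IsRelCycle (A ∪ B ∪ C) K)
    (h : G.IsTriangle A B C p q r) : (3 : ℤ) ∈ G.B := by
  rcases hK.isSimpleCycle_or_isEar with ⟨hs, hc⟩ | ⟨x, y, hE⟩
  · have hd : Disjoint (A ∪ B) K := (hK.disj.mono_right Finset.subset_union_left).symm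
    refine ⟨_, (h.cycA.1.union h.cycB.1 h.disjAB).union hs.1 hd, ?_⟩
    rw [b1_union_of_card_inter_le_one hd h.ncomp_union hs.ncomp_eq ?_, h.b1_union, hs.2]
    · norm_num
    · refine (Finset.card_le_card ?_).trans hc
      rw [Finset.inter_comm]
      exact Finset.inter_subset_inter_left (verts_mono Finset.subset_union_left)
  · exact hE.three_mem h rfl


/-! ### Contracting a vertex set -/

/-- The multigraph obtained by mapping the vertices in `U` to `p`. -/
def contract (G : Multigraph V E) (U : Finset V) (p : V) : Multigraph V E :=
  ⟨fun e => (G.ends e).map fun v => if v ∈ U then p else v⟩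

section Contract

variable {U : Finset V} {p : V}

lemma inc_contract (hp : p ∈ U) (e : E) (w : V) :
    (G.contract U p).inc e w =
      if w = p then ∑ v ∈ U, G.inc e v else if w ∈ U then 0 else G.inc e w := by
  induction h : G.ends e with
  | _ a b =>
    have h' : (G.contract U p).ends e =
        s(if a ∈ U then p else a, if b ∈ U then p else b) := by
      simp [contract, h]
    rw [inc_eq _ h', G.sum_inc h, G.inc_eq h]
    grind

lemma deg_contract_self (hp : p ∈ U) (S : Finset E) :
    (G.contract U p).deg S p = ∑ v ∈ U, G.deg S v := by
  simp only [deg_eq_sum_inc, G.inc_contract hp, if_true]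
  rw [Finset.sum_comm]

lemma deg_contract_of_notMem (hp : p ∈ U) (S : Finset E) {w : V} (hw : w ∉ U) :
    (G.contract U p).deg S w = G.deg S w := by
  have : w ≠ p := fun h => hw (h ▸ hp)
  simp only [deg_eq_sum_inc, G.inc_contract hp, if_neg this, if_neg hw]

lemma deg_contract_of_mem (hp : p ∈ U) (S : Finset E) {w : V} (hw : w ∈ U) (hne : w ≠ p) :
    (G.contract U p).deg S w = 0 := by
  simp only [deg_eq_sum_inc, G.inc_contract hp, if_neg hne, if_pos hw, Finset.sum_const_zero]

lemma isCyclic_contract (hp : p ∈ U) {S : Finset E} (h : ∀ v ∉ U, Even (G.deg S v)) :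
    (G.contract U p).IsCyclic S := by
  refine isCyclic_of_forall_ne _ p fun v hv => ?_
  by_cases hvU : v ∈ U
  · simp [G.deg_contract_of_mem hp S hvU hv]
  · rw [G.deg_contract_of_notMem hp S hvU]
    exact h v hvU

/-- A forest cannot have all valencies but one at least `3`. -/
lemma exists_cyclic_of_three_le {S : Finset E} (hS : S.Nonempty) (p : V)
    (h : ∀ v ∈ G.verts S, v ≠ p → 3 ≤ G.deg S v) :
    ∃ C ⊆ S, C.Nonempty ∧ G.IsCyclic C := by
  refine G.exists_cyclic_nonempty ?_
  have h1 := G.sum_deg (subset_refl (G.verts S))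
  have h2 : 3 * ((G.verts S).card - 1) ≤ ∑ v ∈ G.verts S, G.deg S v := by
    calc 3 * ((G.verts S).card - 1) ≤ 3 * ((G.verts S).erase p).card :=
          Nat.mul_le_mul_left _ Finset.pred_card_le_card_erase
      _ = ∑ v ∈ (G.verts S).erase p, 3 := by rw [Finset.sum_const, smul_eq_mul, mul_comm]
      _ ≤ ∑ v ∈ (G.verts S).erase p, G.deg S v := Finset.sum_le_sum fun v hv =>
          h v (Finset.mem_of_mem_erase hv) (Finset.ne_of_mem_erase hv)
      _ ≤ _ := Finset.sum_le_sum_of_subset (Finset.erase_subset _ _)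
  have h3 := G.ncomp_pos hS
  have h4 := Finset.card_pos.2 hS
  rw [b1]
  omega

lemma isCyclic_singleton {e : E} {v : V} (h : G.ends e = Sym2.diag v) : G.IsCyclic {e} := by
  refine G.isCyclic_of_forall_ne v fun w hw => ?_
  have h' : G.ends e = s(v, v) := h
  simp [deg_eq_sum_inc, G.inc_eq h', hw.symm]

theorem exists_isRelCycle {D : Finset E} (hD : D.Nonempty)
    (hne : (Finset.univ \ D).Nonempty)
    (h : ∀ v ∈ G.verts (Finset.univ \ D), v ∉ G.verts D →
      3 ≤ G.deg (Finset.univ \ D) v ∨ ∃ e ∈ Finset.univ \ D, G.ends e = Sym2.diag v) :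
    ∃ K, G.IsRelCycle D K := by
  classical
  obtain ⟨p, hp⟩ := G.verts_nonempty hD
  set U := G.verts D
  set S := Finset.univ \ D
  have hex : ∃ C ⊆ S, C.Nonempty ∧ (G.contract U p).IsCyclic C := by
    by_cases hl : ∃ v, ∃ e ∈ S, G.ends e = Sym2.diag v
    · obtain ⟨v, e, he, hev⟩ := hl
      exact ⟨{e}, by simpa using he, Finset.singleton_nonempty e,
        G.isCyclic_contract hp fun w _ => G.isCyclic_singleton hev w⟩
    · refine exists_cyclic_of_three_le hne p fun v hv hvp => ?_
      rw [← deg_pos_iff] at hv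
      by_cases hvU : v ∈ U
      · rw [G.deg_contract_of_mem hp S hvU hvp] at hv
        omega
      · rw [G.deg_contract_of_notMem hp S hvU] at hv ⊢
        exact (h v (G.deg_pos_iff.1 hv) hvU).resolve_right fun h' => hl ⟨v, h'⟩
  obtain ⟨C, hCS, hC, hcyc⟩ := hex
  obtain ⟨K, hK, hmin⟩ := Finset.exists_min_image
    (Finset.univ.filter fun K => K ⊆ S ∧ K.Nonempty ∧ (G.contract U p).IsCyclic K) Finset.card
    ⟨C, by simp only [Finset.mem_filter, Finset.mem_univ, true_and]; exact ⟨hCS, hC, hcyc⟩⟩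
  simp only [Finset.mem_filter, Finset.mem_univ, true_and] at hK hmin
  obtain ⟨hKS, hK0, hKc⟩ := hK
  have hmin' : ∀ T ⊆ K, (G.contract U p).IsCyclic T → T = ∅ ∨ T = K := fun T hT hTc => by
    refine (Finset.eq_empty_or_nonempty T).imp_right fun hT0 => ?_
    exact Finset.eq_of_subset_of_card_le hT (hmin T ⟨hT.trans hKS, hT0, hTc⟩)
  have hsimple := isSimpleCycle_of_forall hKc hK0 hmin'
  refine ⟨K, ?_, hK0, fun v hv => ?_, ?_, fun T hT hTe => hmin' T hT (G.isCyclic_contract hp hTe)⟩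
  · exact Finset.disjoint_of_subset_left hKS Finset.sdiff_disjoint
  · rw [← G.deg_contract_of_notMem hp K hv]
    exact hKc v
  · rw [← G.deg_contract_self hp]
    by_cases hpK : p ∈ (G.contract U p).verts K
    · exact (hsimple.deg_eq hpK).le
    · rw [deg_eq_zero _ hpK]
      omega

end Contract

/-! ### Recognising the fat triangle -/

lemma IsSimpleCycle.not_isDiag {C : Finset E} (hC : G.IsSimpleCycle C) {x y : V}
    (hx : x ∈ G.verts C) (hy : y ∈ G.verts C) (hxy : x ≠ y) {e : E} (he : e ∈ C) :
    ¬ (G.ends e).IsDiag := by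
  intro hd
  induction h : G.ends e with
  | _ a b =>
    rw [h, Sym2.mk_isDiag_iff] at hd
    subst hd
    rcases hC.eq_empty_or_eq (Finset.singleton_subset_iff.2 he) (G.isCyclic_singleton h) with
      h0 | rfl
    · simp at h0
    · simp only [mem_verts, Finset.mem_singleton, exists_eq_left, h, Sym2.mem_iff, or_self]
        at hx hy
      exact hxy (hx.trans hy.symm)

lemma IsSimpleCycle.card_eq_two {C : Finset E} (hC : G.IsSimpleCycle C) {x y : V}
    (hxy : x ≠ y) (hv : G.verts C = {x, y}) : C.card = 2 := by
  have h1 := G.sum_deg hv.le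
  rw [← hv, Finset.sum_congr rfl fun v h => hC.deg_eq h, hv, Finset.sum_const,
    Finset.card_pair hxy, smul_eq_mul] at h1
  omega

lemma IsSimpleCycle.ends_eq {C : Finset E} (hC : G.IsSimpleCycle C) {x y : V}
    (hxy : x ≠ y) (hv : G.verts C = {x, y}) {e : E} (he : e ∈ C) : G.ends e = s(x, y) := by
  have hd := hC.not_isDiag (x := x) (y := y) (by simp [hv]) (by simp [hv]) hxy he
  have hsub : ∀ v ∈ G.ends e, v = x ∨ v = y := fun v hve => by
    simpa [hv] using G.mem_verts.2 ⟨e, he, hve⟩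
  induction h : G.ends e with
  | _ a b =>
    rw [h] at hd hsub
    rw [Sym2.mk_isDiag_iff] at hd
    have ha := hsub a (by simp)
    have hb := hsub b (by simp)
    rw [Sym2.eq_iff]
    grind

namespace IsTriangle

variable {A B C : Finset E} {p q r : V}

lemma not_isDiag (h : G.IsTriangle A B C p q r) {e : E} (he : e ∈ A ∪ B ∪ C) :
    ¬ (G.ends e).IsDiag := by
  have hp := h.mem_interAB.2 rfl
  have hq := h.mem_interAC.2 rfl
  have hr := h.mem_interBC.2 rfl
  simp only [Finset.mem_union] at he
  rcases he with (he | he) | he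
  · exact h.cycA.not_isDiag hp.1 hq.1 h.p_ne_q he
  · exact h.cycB.not_isDiag hp.2 hr.1 h.p_ne_r he
  · exact h.cycC.not_isDiag hq.2 hr.2 h.q_ne_r he

lemma mem_of_three_le_deg (h : G.IsTriangle A B C p q r) {v : V}
    (hv : 3 ≤ G.deg (A ∪ B ∪ C) v) : v = p ∨ v = q ∨ v = r := by
  rw [G.deg_union h.disjoint_union, G.deg_union h.disjAB] at hv
  have hdeg : ∀ T, G.IsSimpleCycle T → v ∈ G.verts T ∧ G.deg T v = 2 ∨ G.deg T v = 0 :=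
    fun T hT => (em (v ∈ G.verts T)).imp (fun h' => ⟨h', hT.deg_eq h'⟩) G.deg_eq_zero
  have hAB := h.mem_interAB (v := v)
  have hAC := h.mem_interAC (v := v)
  have hBC := h.mem_interBC (v := v)
  rcases hdeg A h.cycA with ⟨hA, hA'⟩ | hA' <;> rcases hdeg B h.cycB with ⟨hB, hB'⟩ | hB' <;>
    rcases hdeg C h.cycC with ⟨hC, hC'⟩ | hC' <;> first | omega | tauto

theorem isFatTriangle (h : G.IsTriangle A B C p q r) (huniv : A ∪ B ∪ C = Finset.univ)
    (hdeg : ∀ v ∈ G.verts Finset.univ, 3 ≤ G.deg Finset.univ v) : G.IsFatTriangle := by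
  have hp := h.mem_interAB.2 rfl
  have hq := h.mem_interAC.2 rfl
  have hr := h.mem_interBC.2 rfl
  have hAB := fun v => h.mem_interAB (v := v)
  have hAC := fun v => h.mem_interAC (v := v)
  have hBC := fun v => h.mem_interBC (v := v)
  have hpq := h.p_ne_q
  have hpr := h.p_ne_r
  have hqr := h.q_ne_r
  have hpqr : ∀ T : Finset E, ∀ v ∈ G.verts T, v = p ∨ v = q ∨ v = r := fun T v hv =>
    h.mem_of_three_le_deg (huniv ▸ hdeg v (verts_mono (Finset.subset_univ T) hv))
  have hvA : G.verts A = {p, q} := by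
    ext v; simp only [Finset.mem_insert, Finset.mem_singleton]; grind
  have hvB : G.verts B = {p, r} := by
    ext v; simp only [Finset.mem_insert, Finset.mem_singleton]; grind
  have hvC : G.verts C = {q, r} := by
    ext v; simp only [Finset.mem_insert, Finset.mem_singleton]; grind
  have heA := fun e he => h.cycA.ends_eq hpq hvA (e := e) he
  have heB := fun e he => h.cycB.ends_eq hpr hvB (e := e) he
  have heC := fun e he => h.cycC.ends_eq hqr hvC (e := e) he
  have hmem : ∀ e, e ∈ A ∨ e ∈ B ∨ e ∈ C := fun e => by
    simpa [or_assoc] using huniv.ge (Finset.mem_univ e)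
  refine ⟨p, q, r, hpq, hpr, hqr, ?_, fun e => h.not_isDiag (huniv.ge (Finset.mem_univ e)),
    ?_, ?_, ?_⟩
  · rw [← huniv, verts_union, verts_union, hvA, hvB, hvC]
    ext v; simp only [Finset.mem_union, Finset.mem_insert, Finset.mem_singleton]; tauto
  · rw [← h.cycA.card_eq_two hpq hvA]
    congr 1
    ext e
    simp only [Finset.mem_filter, Finset.mem_univ, true_and]
    refine ⟨fun he => ?_, heA e⟩
    rcases hmem e with h' | h' | h'
    · exact h'
    · rw [heB e h', Sym2.eq_iff] at he; grind
    · rw [heC e h', Sym2.eq_iff] at he; grind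
  · rw [← h.cycB.card_eq_two hpr hvB]
    congr 1
    ext e
    simp only [Finset.mem_filter, Finset.mem_univ, true_and]
    refine ⟨fun he => ?_, heB e⟩
    rcases hmem e with h' | h' | h'
    · rw [heA e h', Sym2.eq_iff] at he; grind
    · exact h'
    · rw [heC e h', Sym2.eq_iff] at he; grind
  · rw [← h.cycC.card_eq_two hqr hvC]
    congr 1
    ext e
    simp only [Finset.mem_filter, Finset.mem_univ, true_and]
    refine ⟨fun he => ?_, heC e⟩
    rcases hmem e with h' | h' | h'
    · rw [heA e h', Sym2.eq_iff] at he; grind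
    · rw [heB e h', Sym2.eq_iff] at he; grind
    · exact h'

end IsTriangle

lemma Superstable.eq_univ {D : Finset E} (hss : G.Superstable) (hD : D.Nonempty)
    (hK : ∀ K, ¬ G.IsRelCycle D K) : D = Finset.univ := by
  by_contra hne
  obtain ⟨K, h⟩ := exists_isRelCycle (G := G) hD
    (Finset.sdiff_nonempty.2 fun h => hne (Finset.univ_subset_iff.1 h)) fun v hv hvD => by
      refine (hss v (verts_mono (Finset.subset_univ _) hv)).imp (fun h => ?_) ?_
      · have := G.deg_sdiff (Finset.subset_univ D) v
        rw [G.deg_eq_zero hvD] at this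
        omega
      · rintro ⟨e, he⟩
        refine ⟨e, Finset.mem_sdiff.2 ⟨Finset.mem_univ e, fun heD => hvD ?_⟩, he⟩
        exact G.mem_verts.2 ⟨e, heD, by simp [he, Sym2.diag]⟩
  exact hK K h
end Multigraph

/-- A superstable graph with `3 ∉ B_Γ` containing some `m > 3` in `B_Γ` has
`b₁(Γ) = 4` and is the fat triangle. -/
theorem superstable_three_not_mem_B {V E : Type} [Fintype V] [Fintype E]
    [DecidableEq V] [DecidableEq E] (G : Multigraph V E)
    (hss : G.Superstable) (h3 : (3 : ℤ) ∉ G.B)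
    (m : ℤ) (hm : m ∈ G.B) (hm3 : 3 < m) :
    G.b1 Finset.univ = 4 ∧ G.IsFatTriangle := by
  obtain ⟨D, hD⟩ := Multigraph.exists_isMinimalLarge h3 hm hm3
  obtain ⟨A, B, C, p, q, r, h, rfl⟩ := hD.exists_isTriangle
  have huniv : A ∪ B ∪ C = Finset.univ := hss.eq_univ
    (h.cycC.nonempty.mono Finset.subset_union_right) fun K hK => h3 (hK.three_mem h)
  refine ⟨huniv ▸ h.b1_union_union, h.isFatTriangle huniv fun v hv => ?_⟩
  refine (hss v hv).resolve_right fun ⟨e, he⟩ => ?_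
  refine h.not_isDiag (huniv.ge (Finset.mem_univ e)) ?_
  rw [he]
  exact Sym2.diag_isDiag v
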